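/- arXiv:0902.4608 — 2 statements merged into one kernel-verified Lean document; each statement's English description precedes it below -/
import Mathlib

section
/- Fix an integer m ≥ 0 and define two (m+1)×(m+1) matrices over K, indexed by 0 ≤ i, j ≤ m: A_{ij} = [2i−2m−1 choose i−j] and B_{ij} = ([2m−2i+1]/[2m−2j+1]) · [2m−2j+1 choose i−j], where [n choose k] = 0 whenever k < 0. Then A and B are mutually inverse: A·B = B·A = I. -/
open Finset

/-- Symmetric q-integer `[n] = (qⁿ − q⁻ⁿ)/(q − q⁻¹)` for `n : ℤ`. -/
noncomputable def qint {K : Type*} [Field K] (q : K) (n : ℤ) : K :=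
  (q ^ n - q ^ (-n)) / (q - q⁻¹)

/-- q-factorial `[n]! = [1][2]⋯[n]`. -/
noncomputable def qfact {K : Type*} [Field K] (q : K) : ℕ → K
  | 0 => 1
  | n + 1 => qfact q n * qint q ((n : ℤ) + 1)

/-- Generalized q-binomial `[n choose k] = [n][n−1]⋯[n−k+1]/[k]!` for `n : ℤ`, `k : ℕ`. -/
noncomputable def qbinomG {K : Type*} [Field K] (q : K) (n : ℤ) (k : ℕ) : K :=
  (∏ i ∈ Finset.range k, qint q (n - i)) / qfact q k

/-- Generalized q-binomial `[n choose k]` for `n k : ℤ`, vanishing for `k < 0`. -/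
noncomputable def qbinomI {K : Type*} [Field K] (q : K) (n k : ℤ) : K :=
  if k < 0 then 0 else qbinomG q n k.toNat

theorem qint_neg {K : Type*} [Field K] (q : K) (n : ℤ) : qint q (-n) = -qint q n := by
  simp only [qint, neg_neg]
  ring

theorem qint_ne_zero {K : Type*} [Field K] {q : K}
    (hq : ∀ n : ℕ, 1 ≤ n → q ^ (n : ℤ) ≠ q ^ (-(n : ℤ))) {n : ℤ} (hn : 1 ≤ n) :
    qint q n ≠ 0 := by
  lift n to ℕ using by omega
  have h1 := hq 1 le_rfl
  simp only [Nat.cast_one, zpow_one, zpow_neg] at h1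
  exact div_ne_zero (sub_ne_zero.2 (hq n (by exact_mod_cast hn))) (sub_ne_zero.2 h1)

theorem qint_mul_add_qint_mul {K : Type*} [Field K] {q : K} (hq0 : q ≠ 0) (N n t : ℤ) :
    qint q (n - t) * qint q (N - t) + qint q t * qint q (N - n - t) =
      qint q (N - 2 * t) * qint q n := by
  simp only [qint, div_mul_div_comm, ← add_div]
  congr 1
  have h2 : N - 2 * t = N - t - t := by ring
  simp only [h2, neg_sub, zpow_sub₀ hq0, zpow_neg]
  have hN := zpow_ne_zero N hq0
  have hn := zpow_ne_zero n hq0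
  have ht := zpow_ne_zero t hq0
  field_simp
  ring

theorem qfact_ne_zero {K : Type*} [Field K] {q : K}
    (hq : ∀ n : ℕ, 1 ≤ n → q ^ (n : ℤ) ≠ q ^ (-(n : ℤ))) (n : ℕ) : qfact q n ≠ 0 := by
  induction n with
  | zero => simp [qfact]
  | succ n ih => exact mul_ne_zero ih (qint_ne_zero hq (by omega))

theorem qbinomG_zero {K : Type*} [Field K] (q : K) (n : ℤ) : qbinomG q n 0 = 1 := by
  simp [qbinomG, qfact]

theorem qbinomG_succ_mul {K : Type*} [Field K] {q : K}
    (hq : ∀ n : ℕ, 1 ≤ n → q ^ (n : ℤ) ≠ q ^ (-(n : ℤ))) (n : ℤ) (k : ℕ) :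
    qbinomG q n (k + 1) * qint q ((k : ℤ) + 1) = qbinomG q n k * qint q (n - k) := by
  have h1 := qfact_ne_zero hq k
  have h2 : qint q ((k : ℤ) + 1) ≠ 0 := qint_ne_zero hq (by omega)
  simp only [qbinomG, qfact, prod_range_succ]
  field_simp

/-- Closed form for the partial sums of the convolution. -/
theorem qint_mul_sum_range {K : Type*} [Field K] {q : K} (hq0 : q ≠ 0)
    (hq : ∀ n : ℕ, 1 ≤ n → q ^ (n : ℤ) ≠ q ^ (-(n : ℤ))) (N : ℤ) (n r : ℕ) (hr : r ≤ n) :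
    qint q n * ∑ t ∈ range r,
        qint q (N - 2 * t) * qbinomG q N t * qbinomG q (2 * n - N) (n - t) =
      -(qint q r * qint q (N - n - r) * qbinomG q N r * qbinomG q (2 * n - N) (n - r)) := by
  induction r with
  | zero => simp [qint]
  | succ t ih =>
    rw [sum_range_succ, mul_add, ih (by omega)]
    obtain ⟨k, rfl⟩ := Nat.exists_eq_add_of_le hr
    have e1 : t + 1 + k - t = k + 1 := by omega
    have e2 : t + 1 + k - (t + 1) = k := by omega
    rw [e1, e2]
    have hC := qbinomG_succ_mul hq N t
    have hD := qbinomG_succ_mul hq (2 * ((t + 1 + k : ℕ) : ℤ) - N) k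
    have hI := qint_mul_add_qint_mul hq0 N ((t + 1 + k : ℕ) : ℤ) t
    have e3 : 2 * ((t + 1 + k : ℕ) : ℤ) - N - k =
        -(N - ((t + 1 + k : ℕ) : ℤ) - ((t + 1 : ℕ) : ℤ)) := by push_cast; ring
    have e4 : ((t + 1 + k : ℕ) : ℤ) - t = (k : ℤ) + 1 := by push_cast; ring
    rw [e3, qint_neg] at hD
    rw [e4] at hI
    have e5 : ((t + 1 : ℕ) : ℤ) = (t : ℤ) + 1 := by push_cast; ring
    rw [e5] at hD ⊢
    generalize qbinomG q (2 * ((t + 1 + k : ℕ) : ℤ) - N) (k + 1) = D at *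
    generalize qbinomG q (2 * ((t + 1 + k : ℕ) : ℤ) - N) k = D' at *
    linear_combination (-(qbinomG q N t * D)) * hI
      + qint q (N - ((t + 1 + k : ℕ) : ℤ) - ((t : ℤ) + 1)) * D' * hC
      + qbinomG q N t * qint q (N - t) * hD

theorem sum_qint_mul_qbinomG {K : Type*} [Field K] {q : K} (hq0 : q ≠ 0)
    (hq : ∀ n : ℕ, 1 ≤ n → q ^ (n : ℤ) ≠ q ^ (-(n : ℤ))) (N : ℤ) (n : ℕ) (hn : 1 ≤ n) :
    ∑ t ∈ range (n + 1),
        qint q (N - 2 * t) * qbinomG q N t * qbinomG q (2 * n - N) (n - t) = 0 := by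
  have hn0 : qint q (n : ℤ) ≠ 0 := qint_ne_zero hq (by omega)
  apply (mul_eq_zero.1 _).resolve_left hn0
  rw [sum_range_succ, mul_add, qint_mul_sum_range hq0 hq N n n le_rfl]
  rw [show N - 2 * (n : ℤ) = N - n - n by ring]
  ring

theorem qbinomI_of_neg {K : Type*} [Field K] (q : K) (n : ℤ) {k : ℤ} (hk : k < 0) :
    qbinomI q n k = 0 := if_pos hk

theorem qbinomI_natCast {K : Type*} [Field K] (q : K) (n : ℤ) (k : ℕ) :
    qbinomI q n k = qbinomG q n k := by
  simp [qbinomI]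

/-- The matrices `A_{ij} = [2i−2m−1 choose i−j]` and
`B_{ij} = ([2m−2i+1]/[2m−2j+1]) [2m−2j+1 choose i−j]` (indices `0 ≤ i,j ≤ m`)
are mutually inverse. -/
theorem stmt4 {K : Type*} [Field K] [CharZero K] (q : K) (hq0 : q ≠ 0)
    (hq : ∀ n : ℕ, 1 ≤ n → q ^ (n : ℤ) ≠ q ^ (-(n : ℤ))) (m : ℕ)
    (A B : Matrix (Fin (m + 1)) (Fin (m + 1)) K)
    (hA : ∀ i j, A i j = qbinomI q (2 * (i : ℤ) - 2 * (m : ℤ) - 1) ((i : ℤ) - (j : ℤ)))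
    (hB : ∀ i j, B i j =
      qint q (2 * (m : ℤ) - 2 * (i : ℤ) + 1) / qint q (2 * (m : ℤ) - 2 * (j : ℤ) + 1) *
        qbinomI q (2 * (m : ℤ) - 2 * (j : ℤ) + 1) ((i : ℤ) - (j : ℤ))) :
    A * B = 1 ∧ B * A = 1 := by
  suffices h : A * B = 1 from ⟨h, mul_eq_one_comm.1 h⟩
  ext i j
  rw [Matrix.mul_apply]
  simp only [hA, hB]
  rw [Fin.sum_univ_eq_sum_range (fun k : ℕ =>
    qbinomI q (2 * (i : ℤ) - 2 * (m : ℤ) - 1) ((i : ℤ) - (k : ℤ)) *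
      (qint q (2 * (m : ℤ) - 2 * (k : ℤ) + 1) / qint q (2 * (m : ℤ) - 2 * (j : ℤ) + 1) *
        qbinomI q (2 * (m : ℤ) - 2 * (j : ℤ) + 1) ((k : ℤ) - (j : ℤ)))) (m + 1)]
  have hi := i.isLt
  have hj := j.isLt
  rw [← sum_subset (s₁ := Ico (j : ℕ) (i + 1))
    (fun k hk => by simp only [mem_Ico, mem_range] at hk ⊢; omega)
    (fun k _ hk => by
      rw [mem_Ico] at hk
      rcases lt_or_ge k (j : ℕ) with h | h
      · rw [qbinomI_of_neg q _ (show (k : ℤ) - (j : ℤ) < 0 by omega), mul_zero, mul_zero]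
      · rw [qbinomI_of_neg q _ (show (i : ℤ) - (k : ℤ) < 0 by omega), zero_mul])]
  rcases lt_or_ge (i : ℕ) (j : ℕ) with hij | hij
  · rw [Ico_eq_empty (by omega), sum_empty, Matrix.one_apply_ne (by rintro rfl; omega)]
  have hN : qint q (2 * (m : ℤ) - 2 * (j : ℤ) + 1) ≠ 0 := qint_ne_zero hq (by omega)
  obtain ⟨n, hn⟩ := Nat.exists_eq_add_of_le hij
  rw [sum_Ico_eq_sum_range, show (i : ℕ) + 1 - j = n + 1 by omega]
  trans (∑ t ∈ range (n + 1), qint q (2 * (m : ℤ) - 2 * (j : ℤ) + 1 - 2 * t) *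
      qbinomG q (2 * (m : ℤ) - 2 * (j : ℤ) + 1) t *
      qbinomG q (2 * n - (2 * (m : ℤ) - 2 * (j : ℤ) + 1)) (n - t)) /
      qint q (2 * (m : ℤ) - 2 * (j : ℤ) + 1)
  · rw [sum_div]
    refine sum_congr rfl fun t ht => ?_
    rw [mem_range] at ht
    rw [show (i : ℤ) - ((j + t : ℕ) : ℤ) = ((n - t : ℕ) : ℤ) by omega,
      show ((j + t : ℕ) : ℤ) - (j : ℤ) = (t : ℤ) by omega,
      show 2 * (i : ℤ) - 2 * (m : ℤ) - 1 = 2 * n - (2 * (m : ℤ) - 2 * (j : ℤ) + 1) by omega,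
      show 2 * (m : ℤ) - 2 * ((j + t : ℕ) : ℤ) + 1 = 2 * (m : ℤ) - 2 * (j : ℤ) + 1 - 2 * t by
        omega,
      qbinomI_natCast, qbinomI_natCast]
    ring
  · rcases Nat.eq_zero_or_pos n with rfl | hpos
    · obtain rfl : i = j := Fin.ext (by omega)
      simp [qbinomG_zero, hN]
    · rw [sum_qint_mul_qbinomG hq0 hq _ n hpos, zero_div,
        Matrix.one_apply_ne (by rintro rfl; omega)]
end

section
/- For all integers 0 ≤ s ≤ m, the following identity of terminating hypergeometric polynomials holds in ℚ[x]: Σ_{i=0}^{m−s} ( (s−m)_i (s+1)_i / ((2s+2)_i · i!) ) · (1 − x)^i = (m!(2s+1)!/(s!(m+s+1)!)) · Σ_{i=0}^{m−s} ( (s−m)_i (s+1)_i / ((−m)_i · i!) ) · x^i, i.e., ₂F₁(s−m, s+1; 2s+2; 1−x) = (m!(2s+1)!/(s!(m+s+1)!)) · ₂F₁(s−m, s+1; −m; x) as polynomials; note (−m)_i ≠ 0 for 0 ≤ i ≤ m−s. -/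
open Polynomial Finset

/-- Ordinary Pochhammer symbol `(a)_i = a(a+1)⋯(a+i−1)` for `a : ℤ`, viewed in `ℚ`. -/
def pochQ (a : ℤ) (i : ℕ) : ℚ :=
  ∏ t ∈ Finset.range i, ((a : ℚ) + (t : ℚ))

/-- If `β` satisfies the Beta function recursion, then expanding `(1 - (1 - x) t) ^ n` in two ways
and applying `t ^ a * (1 - t) ^ b ↦ β a b` gives the same result. -/
theorem sum_choose_mul_of_beta_rec {R : Type*} [CommRing R] (β : ℕ → ℕ → R)
    (hβ : ∀ a b, β a b = β (a + 1) b + β a (b + 1)) (x : R) (n a b : ℕ) :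
    ∑ p ∈ antidiagonal n, (n.choose p.1 : R) * (β (a + p.1) b * (x - 1) ^ p.1) =
      ∑ p ∈ antidiagonal n, (n.choose p.1 : R) * (β (a + p.1) (b + p.2) * x ^ p.1) := by
  induction n generalizing a b with
  | zero => simp
  | succ n ih =>
    have choose_symm : ∀ f : ℕ → ℕ → R,
        ∑ p ∈ antidiagonal n, (n.choose p.2 : R) * f p.1 p.2 =
          ∑ p ∈ antidiagonal n, (n.choose p.1 : R) * f p.1 p.2 := fun f =>
      sum_congr rfl fun p hp => by rw [Nat.choose_symm_of_eq_add (mem_antidiagonal.1 hp).symm]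
    rw [sum_antidiagonal_choose_succ_mul (fun i _ => β (a + i) b * (x - 1) ^ i),
      sum_antidiagonal_choose_succ_mul (fun i j => β (a + i) (b + j) * x ^ i),
      choose_symm (fun i _ => β (a + (i + 1)) b * (x - 1) ^ (i + 1)),
      choose_symm (fun i j => β (a + (i + 1)) (b + j) * x ^ (i + 1))]
    have hb := ih a (b + 1)
    have ha := congrArg (x * ·) (ih (a + 1) b)
    simp only [mul_sum] at ha
    have hr : ∑ p ∈ antidiagonal n, (n.choose p.1 : R) * (β (a + p.1) (b + (p.2 + 1)) * x ^ p.1) =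
        ∑ p ∈ antidiagonal n, (n.choose p.1 : R) * (β (a + p.1) (b + 1 + p.2) * x ^ p.1) :=
      sum_congr rfl fun p _ => by rw [add_right_comm b 1, add_assoc b]
    have hr' : ∑ p ∈ antidiagonal n,
          (n.choose p.1 : R) * (β (a + (p.1 + 1)) (b + p.2) * x ^ (p.1 + 1)) =
        ∑ p ∈ antidiagonal n,
          x * ((n.choose p.1 : R) * (β (a + 1 + p.1) (b + p.2) * x ^ p.1)) :=
      sum_congr rfl fun p _ => by rw [add_right_comm a 1, add_assoc a]; ring
    rw [hr, hr', ← hb, ← ha, ← sum_add_distrib, ← sum_add_distrib]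
    refine sum_congr rfl fun p _ => ?_
    rw [hβ (a + p.1) b, add_right_comm a 1, add_assoc a p.1 1]
    ring

theorem beta_rec (a b : ℕ) :
    ((a.factorial * b.factorial : ℚ) / (a + b + 1).factorial) =
      ((a + 1).factorial * b.factorial : ℚ) / (a + 1 + b + 1).factorial +
        (a.factorial * (b + 1).factorial : ℚ) / (a + (b + 1) + 1).factorial := by
  rw [show a + 1 + b + 1 = a + b + 1 + 1 by ring, show a + (b + 1) + 1 = a + b + 1 + 1 by ring,
    Nat.factorial_succ (a + b + 1), Nat.factorial_succ a, Nat.factorial_succ b]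
  have := Nat.factorial_ne_zero (a + b + 1)
  push_cast
  field_simp
  ring

theorem pochQ_succ (a : ℤ) (i : ℕ) : pochQ a (i + 1) = pochQ a i * (a + i) :=
  prod_range_succ _ _

theorem pochQ_natCast_add_one (a i : ℕ) :
    pochQ ((a : ℤ) + 1) i = ((a + i).factorial : ℚ) / a.factorial := by
  have := Nat.factorial_ne_zero a
  induction i with
  | zero => simp [pochQ, this]
  | succ i ih =>
    rw [pochQ_succ, ih, ← add_assoc a i 1, Nat.factorial_succ]
    push_cast
    field_simp
    ring

theorem pochQ_neg_natCast (i k : ℕ) :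
    pochQ (-((i + k : ℕ) : ℤ)) i = (-1) ^ i * ((i + k).factorial : ℚ) / k.factorial := by
  induction i generalizing k with
  | zero => simp [pochQ, Nat.factorial_ne_zero]
  | succ i ih =>
    rw [pochQ_succ, show i + 1 + k = i + (k + 1) by ring, ih, Nat.factorial_succ k]
    have := Nat.factorial_ne_zero k
    push_cast
    field_simp
    ring

/-- For `0 ≤ s ≤ m`, in `ℚ[x]`:
`₂F₁(s−m, s+1; 2s+2; 1−x) = (m!(2s+1)!/(s!(m+s+1)!)) ₂F₁(s−m, s+1; −m; x)`,
where both terminating hypergeometric series are polynomials in `x`. -/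
theorem stmt16 (m s : ℕ) (hsm : s ≤ m) :
    ∑ i ∈ Finset.range (m - s + 1),
        Polynomial.C (pochQ ((s : ℤ) - (m : ℤ)) i * pochQ ((s : ℤ) + 1) i /
            (pochQ (2 * (s : ℤ) + 2) i * (i.factorial : ℚ))) *
          (1 - Polynomial.X) ^ i =
      Polynomial.C ((m.factorial * (2 * s + 1).factorial : ℚ) /
          (s.factorial * (m + s + 1).factorial)) *
        ∑ i ∈ Finset.range (m - s + 1),
          Polynomial.C (pochQ ((s : ℤ) - (m : ℤ)) i * pochQ ((s : ℤ) + 1) i /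
              (pochQ (-(m : ℤ)) i * (i.factorial : ℚ))) *
            Polynomial.X ^ i := by
  obtain ⟨n, rfl⟩ := Nat.exists_eq_add_of_le hsm
  have key := sum_choose_mul_of_beta_rec
    (fun a b => C ((a.factorial * b.factorial : ℚ) / (a + b + 1).factorial))
    (fun a b => by rw [beta_rec, C_add]) X n s s
  replace key := congrArg
    (C (((2 * s + 1).factorial : ℚ) / (s.factorial * s.factorial)) * ·) key
  simp only [Nat.sum_antidiagonal_eq_sum_range_succ_mk, mul_sum] at key
  rw [Nat.add_sub_cancel_left, mul_sum]
  convert key using 1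
  all_goals
    refine sum_congr rfl fun i hi => ?_
    obtain ⟨k, rfl⟩ := Nat.exists_eq_add_of_le (Nat.lt_succ_iff.1 (mem_range.1 hi))
    have hs := Nat.factorial_ne_zero s
    have hi := Nat.factorial_ne_zero i
    have hk := Nat.factorial_ne_zero k
    rw [show (s : ℤ) - ((s + (i + k) : ℕ) : ℤ) = -((i + k : ℕ) : ℤ) by push_cast; ring,
      pochQ_neg_natCast, pochQ_natCast_add_one, ← C_eq_natCast,
      Nat.cast_choose ℚ (Nat.le_add_right i k)]
    simp only [Nat.add_sub_cancel_left]
  · rw [show (2 * (s : ℤ) + 2) = ((2 * s + 1 : ℕ) : ℤ) + 1 by push_cast; ring,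
      pochQ_natCast_add_one, show (1 - X : ℚ[X]) = C (-1) * (X - 1) by simp,
      mul_pow, ← C_pow, ← mul_assoc, ← mul_assoc, ← mul_assoc, ← C_mul, ← C_mul, ← C_mul,
      show s + i + s + 1 = 2 * s + 1 + i by ring]
    congr 2
    have h1 := Nat.factorial_ne_zero (2 * s + 1)
    have h2 := Nat.factorial_ne_zero (2 * s + 1 + i)
    have hsign : ((-1 : ℚ) ^ i) * (-1) ^ i = 1 := by rw [← mul_pow]; simp
    field_simp
    linear_combination hsign
  · rw [show s + (i + k) = i + (s + k) by ring, pochQ_neg_natCast,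
      ← mul_assoc, ← mul_assoc, ← mul_assoc, ← C_mul, ← C_mul, ← C_mul,
      show i + (s + k) + s + 1 = s + i + (s + k) + 1 by ring]
    congr 2
    have h1 := Nat.factorial_ne_zero (s + k)
    have h2 := Nat.factorial_ne_zero (i + (s + k))
    have h3 := Nat.factorial_ne_zero (s + i + (s + k) + 1)
    field_simp
end
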